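/- Let k ≥ 1 be an integer and ω ≥ 1. For a Schwartz function ψ on ℝ^{3k} (variables r_j = (x_j,z_j) ∈ ℝ² × ℝ, j = 1,…,k), define for each j the projections P₀^j ψ (projection in the z_j-variable onto the span of h₁) and P₁^j = id − P₀^j, and for α = (α₁,…,α_k) ∈ {0,1}^k set P_α = P_{α₁}^1 ⋯ P_{α_k}^k and |α| = α₁ + ⋯ + α_k. Then for every α ∈ {0,1}^k, ‖P_α ψ‖²_{L²(ℝ^{3k})} ≤ ω^{-|α|} ⟨ψ, ∏_{j=1}^k S̃_j² ψ⟩, where S̃_j² is the differential operator S̃_j² ψ = ψ − Δ_{x_j}ψ + ω(−ψ − ∂_{z_j}²ψ + z_j²ψ). -/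

import Mathlib

open MeasureTheory Complex

noncomputable section

/-- ℝ² with the Euclidean norm. -/
abbrev R2 : Type := EuclideanSpace ℝ (Fin 2)

/-- ℝ³ written as ℝ² × ℝ, points r = (x, z). -/
abbrev R3 : Type := R2 × ℝ

/-- Directional derivative of `f` at `p` in the direction `v`. -/
def pd {E F : Type*} [NormedAddCommGroup E] [NormedSpace ℝ E]
    [NormedAddCommGroup F] [NormedSpace ℝ F] (v : E) (f : E → F) (p : E) : F :=
  fderiv ℝ f p v

/-- Second directional derivative in the direction `v`. -/
def pd2 {E F : Type*} [NormedAddCommGroup E] [NormedSpace ℝ E]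
    [NormedAddCommGroup F] [NormedSpace ℝ F] (v : E) (f : E → F) (p : E) : F :=
  pd v (pd v f) p

/-- First coordinate direction in the x-plane. -/
def ex0 : R3 := (EuclideanSpace.single 0 1, 0)

/-- Second coordinate direction in the x-plane. -/
def ex1 : R3 := (EuclideanSpace.single 1 1, 0)

/-- The z-direction. -/
def ez : R3 := (0, 1)

/-- The full Laplacian on ℝ³ = ℝ² × ℝ. -/
def lap3 {F : Type*} [NormedAddCommGroup F] [NormedSpace ℝ F]
    (f : R3 → F) (p : R3) : F :=
  pd2 ex0 f p + pd2 ex1 f p + pd2 ez f p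

/-- The operator `S² f = (1−ω)f − Δf + ω² z² f` on functions on ℝ³. -/
def S2op (ω : ℝ) (f : R3 → ℂ) (p : R3) : ℂ :=
  ((1 - ω : ℝ) : ℂ) * f p - lap3 f p + ((ω ^ 2 * p.2 ^ 2 : ℝ) : ℂ) * f p
/-- ℝ^{3k} as k copies of ℝ³. -/
abbrev RK (k : ℕ) : Type := Fin k → R3

/-- Normalized ground state `h₁(z) = π^{-1/4} e^{-z²/2}` of `−∂_z² + z²`. -/
def h1 (z : ℝ) : ℝ := Real.pi ^ (-(1 : ℝ) / 4) * Real.exp (-z ^ 2 / 2)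

/-- Projection in the `z_j` variable onto the span of `h₁`. -/
def P0j {k : ℕ} (j : Fin k) (f : RK k → ℂ) (p : RK k) : ℂ :=
  (∫ zp : ℝ, f (Function.update p j ((p j).1, zp)) * (h1 zp : ℂ)) * (h1 (p j).2 : ℂ)

/-- Complementary projection `P₁ʲ = id − P₀ʲ`. -/
def P1j {k : ℕ} (j : Fin k) (f : RK k → ℂ) (p : RK k) : ℂ :=
  f p - P0j j f p

/-- `P_α = P_{α₁}¹ ⋯ P_{α_k}^k`, where `α j = true` selects `P₁ʲ` and
`α j = false` selects `P₀ʲ`. -/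
def Palpha {k : ℕ} (α : Fin k → Bool) (f : RK k → ℂ) : RK k → ℂ :=
  (List.finRange k).foldr (fun j g => if α j then P1j j g else P0j j g) f

/-- The direction in ℝ^{3k} pointing in direction `v ∈ ℝ³` in the j-th particle slot. -/
def dirK {k : ℕ} (j : Fin k) (v : R3) : RK k := fun i => if i = j then v else 0

/-- `S̃_j² f = f − Δ_{x_j}f + ω(−f − ∂_{z_j}²f + z_j²f)`. -/
def S2tj {k : ℕ} (ω : ℝ) (j : Fin k) (f : RK k → ℂ) (p : RK k) : ℂ :=
  f p - (pd2 (dirK j ex0) f p + pd2 (dirK j ex1) f p) +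
    (ω : ℂ) * (-f p - pd2 (dirK j ez) f p + (((p j).2 ^ 2 : ℝ) : ℂ) * f p)

/-- The product `∏_{j=1}^k S̃_j²` (composition of the commuting operators `S̃_j²`). -/
def SprodK {k : ℕ} (ω : ℝ) (f : RK k → ℂ) : RK k → ℂ :=
  (List.finRange k).foldr (fun j g => S2tj ω j g) f

open scoped SchwartzMap

instance instIsAddHaarMeasureR3 : (volume : Measure R3).IsAddHaarMeasure :=
  Measure.prod.instIsAddHaarMeasure volume volume

instance instIsAddHaarMeasureRK (k : ℕ) : (volume : Measure (RK k)).IsAddHaarMeasure :=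
  Measure.pi.isAddHaarMeasure _

theorem hasTemperateGrowth_coord {k : ℕ} (j : Fin k) :
    Function.HasTemperateGrowth (fun p : RK k => (((p j).2 : ℝ) : ℂ)) :=
  (Complex.ofRealCLM ∘L ContinuousLinearMap.snd ℝ R2 ℝ ∘L
    ContinuousLinearMap.proj (R := ℝ) (φ := fun _ : Fin k => R3) j).hasTemperateGrowth

/-- Multiplication by the coordinate `z_j` on Schwartz functions. -/
def mulZ {k : ℕ} (j : Fin k) : 𝓢(RK k, ℂ) →L[ℂ] 𝓢(RK k, ℂ) :=
  SchwartzMap.smulLeftCLM ℂ (fun p : RK k => (((p j).2 : ℝ) : ℂ))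

/-- Directional derivative on Schwartz functions. -/
def dirD {k : ℕ} (v : RK k) : 𝓢(RK k, ℂ) →L[ℂ] 𝓢(RK k, ℂ) :=
  LineDeriv.lineDerivOpCLM ℂ 𝓢(RK k, ℂ) v

/-- The annihilation operator `∂_{z_j} + z_j` on Schwartz functions. -/
def annih {k : ℕ} (j : Fin k) : 𝓢(RK k, ℂ) →L[ℂ] 𝓢(RK k, ℂ) :=
  dirD (dirK j ez) + mulZ j

/-- The operator `S̃_j²` on Schwartz functions. -/
def S2CLM {k : ℕ} (ω : ℝ) (j : Fin k) : 𝓢(RK k, ℂ) →L[ℂ] 𝓢(RK k, ℂ) :=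
  1 - (dirD (dirK j ex0) * dirD (dirK j ex0) + dirD (dirK j ex1) * dirD (dirK j ex1)) +
    (ω : ℂ) • (-1 - dirD (dirK j ez) * dirD (dirK j ez) + mulZ j * mulZ j)

theorem mulZ_apply {k : ℕ} (j : Fin k) (f : 𝓢(RK k, ℂ)) (p : RK k) :
    mulZ j f p = ((p j).2 : ℂ) * f p := by
  simp [mulZ, SchwartzMap.smulLeftCLM_apply_apply (hasTemperateGrowth_coord j)]

theorem dirD_apply {k : ℕ} (v : RK k) (f : 𝓢(RK k, ℂ)) (p : RK k) :
    dirD v f p = fderiv ℝ f p v :=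
  SchwartzMap.lineDerivOp_apply_eq_fderiv v f p

theorem coe_dirD {k : ℕ} (v : RK k) (f : 𝓢(RK k, ℂ)) : ⇑(dirD v f) = pd v ⇑f :=
  funext (dirD_apply v f)

theorem pd2_eq_dirD {k : ℕ} (v : RK k) (f : 𝓢(RK k, ℂ)) (p : RK k) :
    pd2 v (⇑f) p = dirD v (dirD v f) p := by
  rw [pd2, ← coe_dirD, ← coe_dirD]

theorem S2CLM_apply {k : ℕ} (ω : ℝ) (j : Fin k) (f : 𝓢(RK k, ℂ)) :
    S2CLM ω j f = f - (dirD (dirK j ex0) (dirD (dirK j ex0) f) +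
      dirD (dirK j ex1) (dirD (dirK j ex1) f)) +
      (ω : ℂ) • (-f - dirD (dirK j ez) (dirD (dirK j ez) f) + mulZ j (mulZ j f)) := rfl

theorem S2tj_coe {k : ℕ} (ω : ℝ) (j : Fin k) (f : 𝓢(RK k, ℂ)) :
    S2tj ω j ⇑f = ⇑(S2CLM ω j f) := by
  ext p
  simp only [S2tj, pd2_eq_dirD, S2CLM_apply, add_apply, sub_apply, smul_apply, neg_apply,
    mulZ_apply, smul_eq_mul]
  push_cast
  ring

theorem dirD_commute {k : ℕ} (v w : RK k) : Commute (dirD v) (dirD w) := by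
  ext f p
  have h (v w : RK k) : dirD v (dirD w f) p = fderiv ℝ (fderiv ℝ f) p v w := by
    rw [dirD_apply, coe_dirD]
    have h2 : DifferentiableAt ℝ (fderiv ℝ f) p :=
      ((f.smooth 2).fderiv_right (m := 1) (by norm_num)).differentiable (by norm_num) p
    have := (h2.hasFDerivAt.clm_apply (hasFDerivAt_const w p)).fderiv
    change fderiv ℝ (fun q => fderiv ℝ f q w) p v = _
    rw [this]; simp
  change dirD v (dirD w f) p = dirD w (dirD v f) p
  rw [h, h]
  exact ((f.smooth 2).contDiffAt.isSymmSndFDerivAt (by simp)).eq v w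

theorem dirD_mulZ {k : ℕ} (v : RK k) (j : Fin k) (f : 𝓢(RK k, ℂ)) :
    dirD v (mulZ j f) = mulZ j (dirD v f) + ((v j).2 : ℂ) • f := by
  ext p
  let ℓ := Complex.ofRealCLM ∘L ContinuousLinearMap.snd ℝ R2 ℝ ∘L
    ContinuousLinearMap.proj (R := ℝ) (φ := fun _ : Fin k => R3) j
  have h : HasFDerivAt (mulZ j f) _ p :=
    (ℓ.hasFDerivAt.mul (f.hasFDerivAt p)).congr_of_eventuallyEq
      (Filter.Eventually.of_forall fun q => by rw [mulZ_apply]; rfl)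
  rw [dirD_apply, h.fderiv]
  simp [ℓ, mulZ_apply, dirD_apply, mul_comm]

theorem dirD_commute_mulZ {k : ℕ} {v : RK k} {j : Fin k} (h : (v j).2 = 0) :
    Commute (dirD v) (mulZ j) := by
  ext f p
  change dirD v (mulZ j f) p = mulZ j (dirD v f) p
  simp [dirD_mulZ, h]

theorem mulZ_commute {k : ℕ} (i j : Fin k) : Commute (mulZ i) (mulZ j) := by
  ext f p
  change mulZ i (mulZ j f) p = mulZ j (mulZ i f) p
  simp only [mulZ_apply]
  ring

theorem dirK_of_ne {k : ℕ} {i j : Fin k} (h : i ≠ j) (v : R3) : dirK j v i = 0 := if_neg h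

theorem commute_S2CLM {k : ℕ} (ω : ℝ) {j : Fin k} {T : 𝓢(RK k, ℂ) →L[ℂ] 𝓢(RK k, ℂ)}
    (hD : ∀ v, Commute T (dirD (dirK j v))) (hZ : Commute T (mulZ j)) :
    Commute T (S2CLM ω j) := by
  refine (((Commute.one_right T).sub_right (((hD _).mul_right (hD _)).add_right
    ((hD _).mul_right (hD _))))).add_right (Commute.smul_right ?_ _)
  exact (((Commute.one_right T).neg_right).sub_right ((hD _).mul_right (hD _))).add_right
    (hZ.mul_right hZ)

theorem dirD_commute_S2CLM {k : ℕ} (ω : ℝ) {i j : Fin k} (h : i ≠ j) (v : R3) :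
    Commute (dirD (dirK i v)) (S2CLM ω j) :=
  commute_S2CLM ω (fun _ => dirD_commute _ _)
    (dirD_commute_mulZ (by rw [dirK_of_ne h.symm]; rfl))

theorem annih_commute_S2CLM {k : ℕ} (ω : ℝ) {i j : Fin k} (h : i ≠ j) :
    Commute (annih i) (S2CLM ω j) :=
  (dirD_commute_S2CLM ω h ez).add_left <|
    commute_S2CLM ω
      (fun v => (dirD_commute_mulZ (by rw [dirK_of_ne h]; rfl)).symm) (mulZ_commute i j)

/-- Composition of the operators `S̃_j²` along a list of indices. -/
def S2List {k : ℕ} (ω : ℝ) (l : List (Fin k)) : 𝓢(RK k, ℂ) →L[ℂ] 𝓢(RK k, ℂ) :=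
  (l.map (S2CLM ω)).prod

theorem foldr_S2tj {k : ℕ} (ω : ℝ) (l : List (Fin k)) (f : 𝓢(RK k, ℂ)) :
    l.foldr (fun j g => S2tj ω j g) ⇑f = ⇑(S2List ω l f) := by
  induction l with
  | nil => rfl
  | cons j l ih => rw [List.foldr_cons, ih, S2tj_coe]; rfl

theorem commute_S2List {k : ℕ} {ω : ℝ} {l : List (Fin k)} {T : 𝓢(RK k, ℂ) →L[ℂ] 𝓢(RK k, ℂ)}
    (h : ∀ j ∈ l, Commute T (S2CLM ω j)) : Commute T (S2List ω l) :=
  Commute.list_prod_right _ _ fun _ hx => by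
    obtain ⟨j, hj, rfl⟩ := List.mem_map.1 hx
    exact h j hj

/-- The `L²` inner product of Schwartz functions. -/
def innerS {k : ℕ} (f g : 𝓢(RK k, ℂ)) : ℂ := ∫ p, (starRingEnd ℂ) (f p) * g p

theorem integrable_conj_mul {k : ℕ} (f g : 𝓢(RK k, ℂ)) :
    Integrable (fun p => (starRingEnd ℂ) (f p) * g p) :=
  MemLp.integrable_mul (p := 2) (q := 2) (f := fun p => (starRingEnd ℂ) (f p))
    (f.memLp 2 volume).star (g.memLp 2 volume)

theorem innerS_add_right {k : ℕ} (f g h : 𝓢(RK k, ℂ)) :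
    innerS f (g + h) = innerS f g + innerS f h := by
  rw [innerS, innerS, innerS, ← integral_add (integrable_conj_mul f g) (integrable_conj_mul f h)]
  simp [mul_add]

theorem innerS_add_left {k : ℕ} (f g h : 𝓢(RK k, ℂ)) :
    innerS (f + g) h = innerS f h + innerS g h := by
  rw [innerS, innerS, innerS, ← integral_add (integrable_conj_mul f h) (integrable_conj_mul g h)]
  simp [add_mul]

theorem innerS_smul_right {k : ℕ} (c : ℂ) (f g : 𝓢(RK k, ℂ)) :
    innerS f (c • g) = c * innerS f g := by
  rw [innerS, innerS, ← integral_const_mul]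
  congr 1 with p
  simp only [smul_apply, smul_eq_mul]
  ring

theorem innerS_neg_right {k : ℕ} (f g : 𝓢(RK k, ℂ)) : innerS f (-g) = -innerS f g := by
  simpa using innerS_smul_right (-1) f g

theorem innerS_sub_right {k : ℕ} (f g h : 𝓢(RK k, ℂ)) :
    innerS f (g - h) = innerS f g - innerS f h := by
  rw [sub_eq_add_neg, innerS_add_right, innerS_neg_right, sub_eq_add_neg]

theorem innerS_dirD {k : ℕ} (v : RK k) (f g : 𝓢(RK k, ℂ)) :
    innerS f (dirD v g) = -innerS (dirD v f) g :=
  SchwartzMap.integral_bilinear_lineDerivOp_right_eq_neg_left (μ := volume) f g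
    ((ContinuousLinearMap.mul ℝ ℂ).comp (Complex.conjCLE : ℂ →L[ℝ] ℂ)) v

theorem innerS_mulZ {k : ℕ} (j : Fin k) (f g : 𝓢(RK k, ℂ)) :
    innerS f (mulZ j g) = innerS (mulZ j f) g := by
  rw [innerS, innerS]
  congr 1 with p
  simp only [mulZ_apply, map_mul, Complex.conj_ofReal]
  ring

theorem innerS_annih {k : ℕ} (j : Fin k) (f g : 𝓢(RK k, ℂ)) :
    innerS (annih j f) (annih j g) =
      innerS f (-g - dirD (dirK j ez) (dirD (dirK j ez) g) + mulZ j (mulZ j g)) := by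
  have h1 : (dirK j ez j).2 = 1 := by simp [dirK, ez]
  simp only [annih, add_apply, innerS_add_left, innerS_add_right,
    innerS_sub_right, innerS_neg_right, innerS_dirD _ f, ← innerS_mulZ]
  rw [← neg_eq_iff_eq_neg.2 (innerS_dirD (dirK j ez) f (mulZ j g)), dirD_mulZ, h1,
    innerS_add_right, innerS_smul_right, innerS_mulZ j f (dirD _ g)]
  simp
  ring

theorem innerS_S2CLM {k : ℕ} (ω : ℝ) (j : Fin k) (f g : 𝓢(RK k, ℂ)) :
    innerS f (S2CLM ω j g) = innerS f g + innerS (dirD (dirK j ex0) f) (dirD (dirK j ex0) g) +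
      innerS (dirD (dirK j ex1) f) (dirD (dirK j ex1) g) +
      ω * innerS (annih j f) (annih j g) := by
  rw [S2CLM_apply, innerS_add_right, innerS_sub_right, innerS_add_right, innerS_smul_right,
    ← innerS_annih, innerS_dirD _ f, innerS_dirD _ f]
  ring

theorem innerS_S2List_cons {k : ℕ} (ω : ℝ) {j : Fin k} {l : List (Fin k)} (hj : j ∉ l)
    (f : 𝓢(RK k, ℂ)) :
    innerS f (S2List ω (j :: l) f) = innerS f (S2List ω l f) +
      innerS (dirD (dirK j ex0) f) (S2List ω l (dirD (dirK j ex0) f)) +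
      innerS (dirD (dirK j ex1) f) (S2List ω l (dirD (dirK j ex1) f)) +
      ω * innerS (annih j f) (S2List ω l (annih j f)) := by
  have hne : ∀ i ∈ l, j ≠ i := fun i hi h => hj (h ▸ hi)
  have hD (v : R3) : dirD (dirK j v) (S2List ω l f) = S2List ω l (dirD (dirK j v) f) :=
    DFunLike.congr_fun (commute_S2List fun i hi => dirD_commute_S2CLM ω (hne i hi) v).eq f
  have hA : annih j (S2List ω l f) = S2List ω l (annih j f) :=
    DFunLike.congr_fun (commute_S2List fun i hi => annih_commute_S2CLM ω (hne i hi)).eq f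
  rw [← hD, ← hD, ← hA, ← innerS_S2CLM]
  rfl

theorem h1_pos (z : ℝ) : 0 < h1 z := by unfold h1; positivity

theorem continuous_h1 : Continuous h1 := by unfold h1; fun_prop

theorem hasDerivAt_h1 (z : ℝ) : HasDerivAt h1 (-z * h1 z) z := by
  have h : HasDerivAt (fun z : ℝ => -z ^ 2 / 2) (-z) z := by
    convert! ((hasDerivAt_pow 2 z).neg.div_const 2) using 1
    ring
  convert! h.exp.const_mul (Real.pi ^ (-(1 : ℝ) / 4)) using 1
  simp only [h1]
  ring

theorem h1_sq (z : ℝ) : h1 z ^ 2 = (√Real.pi)⁻¹ * Real.exp (-1 * z ^ 2) := by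
  rw [h1, mul_pow, ← Real.exp_nat_mul, ← Real.rpow_mul_natCast Real.pi_pos.le, Real.sqrt_eq_rpow,
    ← Real.rpow_neg Real.pi_pos.le]
  norm_num
  ring_nf
  simp

theorem integrable_h1_sq : Integrable fun z => h1 z ^ 2 := by
  simp_rw [h1_sq]
  exact (integrable_exp_neg_mul_sq one_pos).const_mul _

theorem integral_h1_sq : ∫ z, h1 z ^ 2 = 1 := by
  simp_rw [h1_sq]
  rw [integral_const_mul, integral_gaussian, div_one,
    inv_mul_cancel₀ (Real.sqrt_ne_zero'.2 Real.pi_pos)]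

theorem integrable_h1 : Integrable h1 := by
  have h := (integrable_exp_neg_mul_sq (b := 1 / 2) (by norm_num)).const_mul
    (Real.pi ^ (-(1 : ℝ) / 4))
  refine h.congr (Filter.Eventually.of_forall fun z => ?_)
  simp only [h1]
  congr 2
  ring

theorem memLp_h1 : MemLp (fun z => (h1 z : ℂ)) 2 := by
  have hc : Continuous fun z => (h1 z : ℂ) := Complex.continuous_ofReal.comp continuous_h1
  rw [memLp_two_iff_integrable_sq_norm hc.aestronglyMeasurable]
  simpa using integrable_h1_sq

theorem integral_norm_sub_smul_h1_sq {u : ℝ → ℂ} (hu : MemLp u 2) (a : ℂ) :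
    ∫ z, ‖u z - a * h1 z‖ ^ 2 =
      (∫ z, ‖u z‖ ^ 2) - 2 * ((starRingEnd ℂ) a * ∫ z, u z * h1 z).re + ‖a‖ ^ 2 := by
  have hi1 : Integrable fun z => ‖u z‖ ^ 2 := hu.integrable_norm_pow two_ne_zero
  have hi2 : Integrable fun z => u z * h1 z := hu.integrable_mul memLp_h1
  have hi3 : Integrable fun z => ((starRingEnd ℂ) a * (u z * h1 z)).re :=
    (hi2.const_mul _).re
  have hp (z : ℝ) : ‖u z - a * h1 z‖ ^ 2 =
      ‖u z‖ ^ 2 - 2 * ((starRingEnd ℂ) a * (u z * h1 z)).re + ‖a‖ ^ 2 * h1 z ^ 2 := by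
    simp only [Complex.sq_norm, Complex.normSq_apply, Complex.sub_re, Complex.sub_im,
      Complex.mul_re, Complex.mul_im, Complex.ofReal_re, Complex.ofReal_im, Complex.conj_re,
      Complex.conj_im]
    ring
  have hre : ∫ z, ((starRingEnd ℂ) a * (u z * h1 z)).re =
      ((starRingEnd ℂ) a * ∫ z, u z * h1 z).re := by
    rw [← integral_const_mul]
    exact integral_re (hi2.const_mul _)
  simp_rw [hp]
  rw [integral_add (by exact hi1.sub (hi3.const_mul 2)) (integrable_h1_sq.const_mul _),
    integral_sub hi1 (hi3.const_mul 2), integral_const_mul, integral_const_mul, integral_h1_sq,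
    hre, mul_one]

theorem integral_norm_sub_proj_sq {u : ℝ → ℂ} (hu : MemLp u 2) :
    ∫ z, ‖u z - (∫ s, u s * h1 s) * h1 z‖ ^ 2 =
      (∫ z, ‖u z‖ ^ 2) - ‖∫ s, u s * h1 s‖ ^ 2 := by
  rw [integral_norm_sub_smul_h1_sq hu, ← Complex.normSq_eq_conj_mul_self, Complex.ofReal_re,
    ← Complex.sq_norm]
  ring

theorem integral_norm_proj_sq_le {u : ℝ → ℂ} (hu : MemLp u 2) :
    ∫ z, ‖(∫ s, u s * h1 s) * (h1 z : ℂ)‖ ^ 2 ≤ ∫ z, ‖u z‖ ^ 2 := by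
  have h0 : 0 ≤ ∫ z, ‖u z - (∫ s, u s * h1 s) * h1 z‖ ^ 2 :=
    integral_nonneg fun _ => by positivity
  rw [integral_norm_sub_proj_sq hu] at h0
  have h (z : ℝ) : ‖(∫ s, u s * h1 s) * (h1 z : ℂ)‖ ^ 2 = ‖∫ s, u s * h1 s‖ ^ 2 * h1 z ^ 2 := by
    rw [norm_mul, mul_pow, Complex.norm_real, Real.norm_eq_abs, sq_abs]
  simp_rw [h]
  rw [integral_const_mul, integral_h1_sq]
  linarith

theorem integral_norm_sub_proj_sq_le {u : ℝ → ℂ} (hu : MemLp u 2) (a : ℂ) :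
    ∫ z, ‖u z - (∫ s, u s * h1 s) * h1 z‖ ^ 2 ≤ ∫ z, ‖u z - a * h1 z‖ ^ 2 := by
  rw [integral_norm_sub_proj_sq hu, integral_norm_sub_smul_h1_sq hu]
  have h : 0 ≤ ‖(∫ s, u s * h1 s) - a‖ ^ 2 := by positivity
  generalize (∫ s, u s * h1 s) = c at h ⊢
  simp only [Complex.sq_norm, Complex.normSq_apply, Complex.sub_re, Complex.sub_im,
      Complex.mul_re, Complex.conj_re, Complex.conj_im] at h ⊢
  linarith

/-- Hardy-type inequality on `[0, T]` for the operator `∂_z + z` with a Dirichlet condition at `0`.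
The proof integrates the identity `‖v - w / t‖² = ‖v‖² - 2 ‖w‖² - d/dt (‖w‖² / t)`. -/
theorem two_mul_integral_norm_sq_le {w v : ℝ → ℂ} (hv : Continuous v)
    (hw : ∀ z, HasDerivAt w (v z - z * w z) z) (hw0 : w 0 = 0) {T : ℝ} (hT : 0 ≤ T) :
    2 * ∫ z in (0 : ℝ)..T, ‖w z‖ ^ 2 ≤ ∫ z in (0 : ℝ)..T, ‖v z‖ ^ 2 := by
  have hwc : Continuous w := continuous_iff_continuousAt.2 fun z => (hw z).continuousAt
  have hFc : Continuous fun z => ‖v z‖ ^ 2 - 2 * ‖w z‖ ^ 2 := by fun_prop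
  have hI (t : ℝ) := (hFc.integral_hasStrictDerivAt 0 t).hasDerivAt
  let G (t : ℝ) : ℝ := (∫ z in (0 : ℝ)..t, (‖v z‖ ^ 2 - 2 * ‖w z‖ ^ 2)) - ‖w t‖ ^ 2 * t⁻¹
  have hG {t : ℝ} (ht : t ≠ 0) : HasDerivAt G (‖v t - ((t⁻¹ : ℝ) : ℂ) * w t‖ ^ 2) t := by
    convert! (hI t).sub ((hw t).norm_sq.mul (hasDerivAt_inv ht)) using 1
    simp only [Complex.sq_norm, Complex.normSq_apply, Complex.sub_re, Complex.sub_im,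
      Complex.mul_re, Complex.mul_im, Complex.ofReal_re, Complex.ofReal_im, Complex.inner,
      Complex.conj_re, Complex.conj_im]
    field_simp
    ring
  have hG0 : ContinuousAt G 0 := by
    refine (hI 0).continuousAt.sub ?_
    have h1 : Filter.Tendsto (fun t : ℝ => t⁻¹ • w t) (nhdsWithin 0 {0}ᶜ)
        (nhds (v 0 - (0 : ℝ) * w 0)) := by
      have := (hasDerivAt_iff_tendsto_slope_zero.1 (hw 0))
      simpa [hw0] using this
    have h2 : Filter.Tendsto w (nhdsWithin 0 {0}ᶜ) (nhds 0) := by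
      have := hwc.tendsto 0
      rw [hw0] at this
      exact this.mono_left nhdsWithin_le_nhds
    have h3 := (h1.norm.mul h2.norm).congr' (f₂ := fun t : ℝ => ‖w t‖ ^ 2 * |t|⁻¹)
      (Filter.Eventually.of_forall fun t => by
        rw [norm_smul, norm_inv, Real.norm_eq_abs]; ring)
    rw [norm_zero, mul_zero] at h3
    rw [continuousAt_iff_punctured_nhds]
    simp only [hw0, norm_zero, ne_eq, OfNat.ofNat_ne_zero, not_false_eq_true, zero_pow, zero_mul]
    refine squeeze_zero_norm (fun t => ?_) h3
    simp
  have hmono : MonotoneOn G (Set.Ici 0) := by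
    refine monotoneOn_of_deriv_nonneg (convex_Ici 0) (fun t ht => ?_) (fun t ht => ?_)
      (fun t ht => ?_)
    · rcases eq_or_ne t 0 with rfl | h
      · exact hG0.continuousWithinAt
      · exact (hG h).continuousAt.continuousWithinAt
    · rw [interior_Ici] at ht
      exact (hG (ne_of_gt ht)).differentiableAt.differentiableWithinAt
    · rw [interior_Ici] at ht
      rw [(hG (ne_of_gt ht)).deriv]
      positivity
  have h := hmono Set.self_mem_Ici hT hT
  have hsub : ∫ z in (0 : ℝ)..T, (‖v z‖ ^ 2 - 2 * ‖w z‖ ^ 2) =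
      (∫ z in (0 : ℝ)..T, ‖v z‖ ^ 2) - 2 * ∫ z in (0 : ℝ)..T, ‖w z‖ ^ 2 := by
    rw [intervalIntegral.integral_sub, intervalIntegral.integral_const_mul] <;>
    exact Continuous.intervalIntegrable (by fun_prop) _ _
  simp only [G, hw0, intervalIntegral.integral_same, hsub] at h
  have : 0 ≤ ‖w T‖ ^ 2 * T⁻¹ := by positivity
  simp at h
  linarith

theorem integral_norm_sq_le_of_hasDerivAt {w v : ℝ → ℂ} (hv : Continuous v)
    (hw : ∀ z, HasDerivAt w (v z - z * w z) z) (hw0 : w 0 = 0)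
    (hwi : MemLp w 2) (hvi : MemLp v 2) :
    ∫ z, ‖w z‖ ^ 2 ≤ ∫ z, ‖v z‖ ^ 2 := by
  have hwc : Continuous w := continuous_iff_continuousAt.2 fun z => (hw z).continuousAt
  have hlim {f : ℝ → ℂ} (hf : MemLp f 2) := intervalIntegral_tendsto_integral
    (hf.integrable_norm_pow two_ne_zero) Filter.tendsto_neg_atTop_atBot Filter.tendsto_id
  refine le_of_tendsto_of_tendsto (hlim hwi) (hlim hvi) ?_
  filter_upwards [Filter.eventually_ge_atTop 0] with T hT
  have hsplit {f : ℝ → ℂ} (hf : Continuous f) : ∫ z in -T..T, ‖f z‖ ^ 2 =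
      (∫ z in (0 : ℝ)..T, ‖f (-z)‖ ^ 2) + ∫ z in (0 : ℝ)..T, ‖f z‖ ^ 2 := by
    rw [intervalIntegral.integral_comp_neg (fun z => ‖f z‖ ^ 2), neg_zero,
      intervalIntegral.integral_add_adjacent_intervals] <;>
    exact Continuous.intervalIntegrable (by fun_prop) _ _
  have hpos := two_mul_integral_norm_sq_le hv hw hw0 hT
  have hneg := two_mul_integral_norm_sq_le (w := fun z => w (-z)) (v := fun z => -v (-z))
    (by fun_prop) (fun z => by
      convert! (hw (-z)).scomp z (hasDerivAt_neg z) using 1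
      simp
      ring) (by simpa using hw0) hT
  simp only [norm_neg] at hneg
  have h0 : 0 ≤ ∫ z in (0 : ℝ)..T, ‖w z‖ ^ 2 :=
    intervalIntegral.integral_nonneg hT fun _ _ => by positivity
  have h0' : 0 ≤ ∫ z in (0 : ℝ)..T, ‖w (-z)‖ ^ 2 :=
    intervalIntegral.integral_nonneg hT fun _ _ => by positivity
  simp only [id]
  rw [hsplit hwc, hsplit hv]
  linarith

/-- Gaussian Poincaré inequality, written for the ground state `h₁`. -/
theorem integral_norm_sub_proj_sq_le_of_hasDerivAt {u v : ℝ → ℂ} (hv : Continuous v)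
    (hu : ∀ z, HasDerivAt u (v z - z * u z) z) (hui : MemLp u 2) (hvi : MemLp v 2) :
    ∫ z, ‖u z - (∫ s, u s * h1 s) * h1 z‖ ^ 2 ≤ ∫ z, ‖v z‖ ^ 2 := by
  have h0 : (h1 0 : ℂ) ≠ 0 := Complex.ofReal_ne_zero.2 (h1_pos 0).ne'
  refine (integral_norm_sub_proj_sq_le hui (u 0 / h1 0)).trans
    (integral_norm_sq_le_of_hasDerivAt hv (fun z => ?_) ?_ (hui.sub (memLp_h1.const_mul _)) hvi)
  · convert! (hu z).sub ((hasDerivAt_h1 z).ofReal_comp.const_mul (u 0 / (h1 0 : ℂ))) using 1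
    push_cast
    ring
  · rw [div_mul_cancel₀ _ h0, sub_self]

/-- Continuous functions decaying faster than any power. -/
structure RapidDecay {E : Type*} [NormedAddCommGroup E] (f : E → ℂ) : Prop where
  continuous : Continuous f
  decay : ∀ N : ℕ, ∃ C : ℝ, ∀ x, (1 + ‖x‖) ^ N * ‖f x‖ ≤ C

theorem RapidDecay.bounded {E : Type*} [NormedAddCommGroup E] {f : E → ℂ} (hf : RapidDecay f) :
    ∃ C : ℝ, ∀ x, ‖f x‖ ≤ C := by
  simpa using hf.decay 0

theorem RapidDecay.sub {E : Type*} [NormedAddCommGroup E] {f g : E → ℂ} (hf : RapidDecay f)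
    (hg : RapidDecay g) : RapidDecay fun x => f x - g x := by
  refine ⟨hf.continuous.sub hg.continuous, fun N => ?_⟩
  obtain ⟨C, hC⟩ := hf.decay N
  obtain ⟨D, hD⟩ := hg.decay N
  refine ⟨C + D, fun x => ?_⟩
  calc (1 + ‖x‖) ^ N * ‖f x - g x‖ ≤ (1 + ‖x‖) ^ N * (‖f x‖ + ‖g x‖) := by
        gcongr
        exact norm_sub_le _ _
    _ ≤ C + D := by linarith [hC x, hD x]

theorem RapidDecay.memLp_two {E : Type*} [NormedAddCommGroup E] [NormedSpace ℝ E]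
    [FiniteDimensional ℝ E] [MeasurableSpace E] [BorelSpace E] {μ : Measure E}
    [μ.IsAddHaarMeasure] {f : E → ℂ} (hf : RapidDecay f) : MemLp f 2 μ := by
  have hm : AEStronglyMeasurable f μ := hf.continuous.aestronglyMeasurable
  rw [memLp_two_iff_integrable_sq_norm hm]
  obtain ⟨C, hC⟩ := hf.bounded
  obtain ⟨D, hD⟩ := hf.decay (Module.finrank ℝ E + 1)
  refine ((integrable_one_add_norm (μ := μ) (E := E) (r := (Module.finrank ℝ E + 1 : ℕ))
    (by push_cast; linarith)).const_mul (C * D)).mono' (hm.norm.pow 2)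
    (Filter.Eventually.of_forall fun x => ?_)
  have hx : 0 < (1 + ‖x‖) ^ (Module.finrank ℝ E + 1) := by positivity
  rw [Real.rpow_neg (by positivity), Real.rpow_natCast, Real.norm_of_nonneg (by positivity),
    ← div_eq_mul_inv, le_div_iff₀ hx]
  calc ‖f x‖ ^ 2 * (1 + ‖x‖) ^ (Module.finrank ℝ E + 1)
      = ‖f x‖ * ((1 + ‖x‖) ^ (Module.finrank ℝ E + 1) * ‖f x‖) := by ring
    _ ≤ C * D := mul_le_mul (hC x) (hD x) (by positivity) ((norm_nonneg _).trans (hC x))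

theorem rapidDecay_schwartz {E : Type*} [NormedAddCommGroup E] [NormedSpace ℝ E]
    (f : SchwartzMap E ℂ) : RapidDecay ⇑f := by
  refine ⟨f.continuous, fun N => ⟨_, fun x => le_of_eq_of_le ?_
    (SchwartzMap.one_add_le_sup_seminorm_apply (𝕜 := ℝ) (m := (N, 0)) le_rfl le_rfl f x)⟩⟩
  rw [norm_iteratedFDeriv_zero]

theorem rapidDecay_h1 : RapidDecay fun z => (h1 z : ℂ) := by
  refine ⟨Complex.continuous_ofReal.comp continuous_h1, fun N =>
    ⟨N.factorial * Real.exp (3 / 2) * Real.pi ^ (-(1 : ℝ) / 4), fun z => ?_⟩⟩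
  have h := Real.pow_div_factorial_le_exp (1 + ‖z‖) (by positivity) N
  rw [div_le_iff₀ (by positivity), Real.norm_eq_abs] at h
  rw [Complex.norm_real, Real.norm_of_nonneg (h1_pos z).le, h1, Real.norm_eq_abs]
  calc (1 + |z|) ^ N * (Real.pi ^ (-(1 : ℝ) / 4) * Real.exp (-z ^ 2 / 2))
      ≤ Real.exp (1 + |z|) * N.factorial *
        (Real.pi ^ (-(1 : ℝ) / 4) * Real.exp (-z ^ 2 / 2)) := by gcongr
    _ = N.factorial * Real.exp (1 + |z| + -z ^ 2 / 2) * Real.pi ^ (-(1 : ℝ) / 4) := by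
        rw [Real.exp_add (1 + |z|)]
        ring
    _ ≤ _ := by
        gcongr
        nlinarith [sq_nonneg (|z| - 1), sq_abs z]

/-- Replace the coordinate `z_j` of `p` by `z`. -/
def setZ {k : ℕ} (j : Fin k) (p : RK k) (z : ℝ) : RK k := Function.update p j ((p j).1, z)

theorem setZ_setZ {k : ℕ} (j : Fin k) (p : RK k) (z t : ℝ) :
    setZ j (setZ j p z) t = setZ j p t := by
  simp [setZ]

theorem setZ_comm {k : ℕ} {i j : Fin k} (h : i ≠ j) (p : RK k) (z t : ℝ) :
    setZ j (setZ i p z) t = setZ i (setZ j p t) z := by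
  simp [setZ, Function.update_of_ne h, Function.update_of_ne h.symm, Function.update_comm h]

@[simp]
theorem setZ_apply_self {k : ℕ} (j : Fin k) (p : RK k) (z : ℝ) : setZ j p z j = ((p j).1, z) := by
  simp [setZ]

theorem setZ_apply_of_ne {k : ℕ} {i j : Fin k} (h : i ≠ j) (p : RK k) (z : ℝ) :
    setZ j p z i = p i := Function.update_of_ne h _ _

theorem continuous_setZ {k : ℕ} (j : Fin k) :
    Continuous fun q : RK k × ℝ => setZ j q.1 q.2 := by
  unfold setZ
  fun_prop

theorem continuous_setZ_left {k : ℕ} (j : Fin k) (z : ℝ) : Continuous fun p : RK k => setZ j p z :=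
  (continuous_setZ j).comp (continuous_id.prodMk continuous_const)

theorem continuous_setZ_right {k : ℕ} (j : Fin k) (p : RK k) : Continuous (setZ j p) :=
  (continuous_setZ j).comp (continuous_const.prodMk continuous_id)

theorem norm_le_norm_setZ {k : ℕ} (j : Fin k) (p : RK k) (z : ℝ) : ‖z‖ ≤ ‖setZ j p z‖ := by
  refine le_trans ?_ (norm_le_pi_norm (setZ j p z) j)
  rw [setZ_apply_self]
  exact le_max_right _ _

theorem norm_le_max_norm_setZ {k : ℕ} (j : Fin k) (p : RK k) (z : ℝ) :
    ‖p‖ ≤ max ‖setZ j p z‖ ‖(p j).2‖ := by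
  refine (pi_norm_le_iff_of_nonneg (by positivity)).2 fun i => ?_
  have hle := norm_le_pi_norm (setZ j p z) i
  rcases eq_or_ne i j with rfl | h
  · rw [setZ_apply_self, Prod.norm_mk] at hle
    exact max_le_max ((le_max_left _ _).trans hle) le_rfl
  · rw [setZ_apply_of_ne h] at hle
    exact hle.trans (le_max_left _ _)

theorem RapidDecay.slice {k : ℕ} {f : RK k → ℂ} (hf : RapidDecay f) (j : Fin k) (p : RK k) :
    RapidDecay fun z => f (setZ j p z) := by
  refine ⟨hf.continuous.comp (continuous_setZ_right j p), fun N => ?_⟩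
  obtain ⟨C, hC⟩ := hf.decay N
  refine ⟨C, fun z => le_trans ?_ (hC (setZ j p z))⟩
  gcongr
  exact norm_le_norm_setZ j p z

/-- The partial inner product of `f` with the ground state in the variable `z_j`. -/
def coeffZ {k : ℕ} (j : Fin k) (f : RK k → ℂ) (p : RK k) : ℂ := ∫ z : ℝ, f (setZ j p z) * h1 z

theorem P0j_eq {k : ℕ} (j : Fin k) (f : RK k → ℂ) (p : RK k) :
    P0j j f p = coeffZ j f p * h1 (p j).2 := rfl

theorem coeffZ_setZ {k : ℕ} (j : Fin k) (f : RK k → ℂ) (p : RK k) (t : ℝ) :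
    coeffZ j f (setZ j p t) = coeffZ j f p := by
  simp only [coeffZ, setZ_setZ]

theorem integrable_slice_mul_h1 {k : ℕ} {f : RK k → ℂ} (hf : RapidDecay f) (j : Fin k)
    (p : RK k) : Integrable fun z => f (setZ j p z) * h1 z :=
  (hf.slice j p).memLp_two.integrable_mul memLp_h1

theorem RapidDecay.P0j {k : ℕ} {f : RK k → ℂ} (hf : RapidDecay f) (j : Fin k) :
    RapidDecay (P0j j f) := by
  obtain ⟨B, hB⟩ := hf.bounded
  refine ⟨?_, fun N => ?_⟩
  · refine Continuous.mul (continuous_of_dominated (F := fun p z => f (setZ j p z) * h1 z)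
      (bound := fun z => B * h1 z)
      (fun p => (integrable_slice_mul_h1 hf j p).aestronglyMeasurable)
      (fun p => Filter.Eventually.of_forall fun z => ?_) (integrable_h1.const_mul B)
      (Filter.Eventually.of_forall fun z =>
        (hf.continuous.comp (continuous_setZ_left j z)).mul continuous_const)) ?_
    · rw [norm_mul, Complex.norm_real, Real.norm_of_nonneg (h1_pos z).le]
      exact mul_le_mul_of_nonneg_right (hB _) (h1_pos z).le
    · exact Complex.continuous_ofReal.comp (continuous_h1.comp (by fun_prop))
  · obtain ⟨C, hC⟩ := hf.decay N
    obtain ⟨D, hD⟩ := rapidDecay_h1.decay N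
    refine ⟨(∫ z, C * h1 z) * D, fun p => ?_⟩
    have hp (z : ℝ) : (1 + ‖p‖) ^ N ≤ (1 + ‖setZ j p z‖) ^ N * (1 + ‖(p j).2‖) ^ N := by
      rw [← mul_pow]
      gcongr
      have h := norm_le_max_norm_setZ j p z
      have h1 := norm_nonneg (setZ j p z)
      have h2 := norm_nonneg (p j).2
      rcases le_max_iff.1 h with h | h <;> nlinarith
    have hc : (1 + ‖p‖) ^ N * ‖coeffZ j f p‖ ≤ (∫ z, C * h1 z) * (1 + ‖(p j).2‖) ^ N := by
      rw [coeffZ, ← Real.norm_of_nonneg (by positivity : 0 ≤ (1 + ‖p‖) ^ N), ← norm_smul,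
        ← integral_smul, ← integral_mul_const]
      refine norm_integral_le_of_norm_le ((integrable_h1.const_mul C).mul_const _)
        (Filter.Eventually.of_forall fun z => ?_)
      rw [norm_smul, Real.norm_of_nonneg (by positivity), norm_mul, Complex.norm_real,
        Real.norm_of_nonneg (h1_pos z).le]
      calc (1 + ‖p‖) ^ N * (‖f (setZ j p z)‖ * h1 z)
          ≤ ((1 + ‖setZ j p z‖) ^ N * (1 + ‖(p j).2‖) ^ N) * (‖f (setZ j p z)‖ * h1 z) :=
            mul_le_mul_of_nonneg_right (hp z) (mul_nonneg (norm_nonneg _) (h1_pos z).le)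
        _ = ((1 + ‖setZ j p z‖) ^ N * ‖f (setZ j p z)‖) * (h1 z * (1 + ‖(p j).2‖) ^ N) := by ring
        _ ≤ C * (h1 z * (1 + ‖(p j).2‖) ^ N) :=
            mul_le_mul_of_nonneg_right (hC _) (mul_nonneg (h1_pos z).le (by positivity))
        _ = C * h1 z * (1 + ‖(p j).2‖) ^ N := by ring
    have hC0 : 0 ≤ C := le_trans (by positivity) (hC 0)
    have hI : 0 ≤ ∫ z, C * h1 z := integral_nonneg fun z => mul_nonneg hC0 (h1_pos z).le
    rw [P0j_eq, norm_mul, ← mul_assoc]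
    calc (1 + ‖p‖) ^ N * ‖coeffZ j f p‖ * ‖(h1 (p j).2 : ℂ)‖
        ≤ (∫ z, C * h1 z) * (1 + ‖(p j).2‖) ^ N * ‖(h1 (p j).2 : ℂ)‖ := by gcongr
      _ = (∫ z, C * h1 z) * ((1 + ‖(p j).2‖) ^ N * ‖(h1 (p j).2 : ℂ)‖) := by ring
      _ ≤ (∫ z, C * h1 z) * D := mul_le_mul_of_nonneg_left (hD _) hI

theorem RapidDecay.P1j {k : ℕ} {f : RK k → ℂ} (hf : RapidDecay f) (j : Fin k) :
    RapidDecay (P1j j f) := hf.sub (hf.P0j j)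

/-- `g = (∂_{z_i} + z_i) f` pointwise. -/
def IsAnnih {k : ℕ} (i : Fin k) (f g : RK k → ℂ) : Prop :=
  ∀ (p : RK k) (z : ℝ), HasDerivAt (fun t => f (setZ i p t))
    (g (setZ i p z) - z * f (setZ i p z)) z

theorem IsAnnih.P0j {k : ℕ} {i j : Fin k} (hij : i ≠ j) {f g : RK k → ℂ} (hf : RapidDecay f)
    (hg : RapidDecay g) (h : IsAnnih i f g) : IsAnnih i (P0j j f) (P0j j g) := by
  intro p z
  obtain ⟨B, hB⟩ := hf.bounded
  obtain ⟨C, hC⟩ := hg.bounded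
  have hB0 : 0 ≤ B := (norm_nonneg _).trans (hB p)
  have hint {φ : RK k → ℂ} (hφ : RapidDecay φ) (t : ℝ) :
      Integrable fun s => φ (setZ i (setZ j p s) t) * h1 s := by
    simp_rw [← setZ_comm hij]
    exact integrable_slice_mul_h1 hφ j _
  have hint' (t : ℝ) : Integrable fun s =>
      (g (setZ i (setZ j p s) t) - t * f (setZ i (setZ j p s) t)) * h1 s := by
    simp only [sub_mul, mul_assoc]
    exact (hint hg t).sub ((hint hf t).const_mul (t : ℂ))
  have key := (hasDerivAt_integral_of_dominated_loc_of_deriv_le (𝕜 := ℝ)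
    (F := fun t s => f (setZ i (setZ j p s) t) * h1 s)
    (F' := fun t s => (g (setZ i (setZ j p s) t) - t * f (setZ i (setZ j p s) t)) * h1 s)
    (bound := fun s => (C + (|z| + 1) * B) * h1 s)
    (Metric.ball_mem_nhds z one_pos)
    (Filter.Eventually.of_forall fun t => (hint hf t).aestronglyMeasurable) (hint hf z)
    (hint' z).aestronglyMeasurable
    (Filter.Eventually.of_forall fun s t ht => by
      rw [norm_mul, Complex.norm_real, Real.norm_of_nonneg (h1_pos s).le]
      refine mul_le_mul_of_nonneg_right ((norm_sub_le _ _).trans (add_le_add (hC _) ?_))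
        (h1_pos s).le
      rw [norm_mul, Complex.norm_real, Real.norm_eq_abs]
      refine mul_le_mul ?_ (hB _) (norm_nonneg _) (by positivity)
      rw [Metric.mem_ball, Real.dist_eq] at ht
      have := abs_sub_abs_le_abs_sub t z
      linarith)
    (integrable_h1.const_mul _)
    (Filter.Eventually.of_forall fun s t _ => (h (setZ j p s) t).mul_const _)).2
  have hcoe (φ : RK k → ℂ) (t : ℝ) : _root_.P0j j φ (setZ i p t) =
      (∫ s, φ (setZ i (setZ j p s) t) * h1 s) * h1 (p j).2 := by
    rw [P0j_eq, coeffZ, setZ_apply_of_ne hij.symm]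
    simp_rw [setZ_comm hij]
  simp_rw [hcoe]
  convert! key.mul_const (h1 (p j).2 : ℂ) using 1
  simp_rw [sub_mul, mul_assoc]
  rw [integral_sub (hint hg z) ((hint hf z).const_mul _), integral_const_mul]
  ring

theorem IsAnnih.P1j {k : ℕ} {i j : Fin k} (hij : i ≠ j) {f g : RK k → ℂ} (hf : RapidDecay f)
    (hg : RapidDecay g) (h : IsAnnih i f g) : IsAnnih i (P1j j f) (P1j j g) := by
  intro p z
  convert! (h p z).sub (h.P0j hij hf hg p z) using 1
  simp only [_root_.P1j]
  ring

theorem integral_norm_sq_le_of_slice {k : ℕ} {f g : RK k → ℂ} (hf : RapidDecay f)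
    (hg : RapidDecay g) (j : Fin k)
    (h : ∀ p, ∫ z, ‖f (setZ j p z)‖ ^ 2 ≤ ∫ z, ‖g (setZ j p z)‖ ^ 2) :
    ∫ p, ‖f p‖ ^ 2 ≤ ∫ p, ‖g p‖ ^ 2 := by
  have hmeas {φ : RK k → ℂ} (hφ : RapidDecay φ) : Measurable fun p => ENNReal.ofReal (‖φ p‖ ^ 2) :=
    (ENNReal.continuous_ofReal.comp (hφ.continuous.norm.pow 2)).measurable
  have hint {φ : RK k → ℂ} (hφ : RapidDecay φ) : Integrable fun p => ‖φ p‖ ^ 2 :=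
    hφ.memLp_two.integrable_norm_pow two_ne_zero
  have hslice {φ : RK k → ℂ} (hφ : RapidDecay φ) (p : RK k) :
      ∫⁻ r : R3, ENNReal.ofReal (‖φ (Function.update p j r)‖ ^ 2) =
        ∫⁻ x : R2, ENNReal.ofReal
          (∫ z, ‖φ (setZ j (Function.update p j (x, (0 : ℝ))) z)‖ ^ 2) := by
    rw [Measure.volume_eq_prod,
      lintegral_prod _ (by exact ((hmeas hφ).comp (measurable_update p)).aemeasurable)]
    congr 1 with x
    rw [ofReal_integral_eq_lintegral_ofReal
      ((hφ.slice j _).memLp_two.integrable_norm_pow two_ne_zero)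
      (Filter.Eventually.of_forall fun _ => by positivity)]
    simp [setZ]
  have hle : ∫⁻ p, ENNReal.ofReal (‖f p‖ ^ 2) ≤ ∫⁻ p, ENNReal.ofReal (‖g p‖ ^ 2) := by
    refine lintegral_le_of_lmarginal_le (μ := fun _ : Fin k => (volume : Measure R3)) {j}
      (hmeas hf) (hmeas hg) ?_
    rw [lmarginal_singleton, lmarginal_singleton]
    intro p
    simp only
    rw [hslice hf, hslice hg]
    exact lintegral_mono fun x => ENNReal.ofReal_le_ofReal (h _)
  rw [← ofReal_integral_eq_lintegral_ofReal (hint hf)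
      (Filter.Eventually.of_forall fun _ => by positivity),
    ← ofReal_integral_eq_lintegral_ofReal (hint hg)
      (Filter.Eventually.of_forall fun _ => by positivity)] at hle
  exact (ENNReal.ofReal_le_ofReal_iff (integral_nonneg fun _ => by positivity)).1 hle

theorem integral_norm_P0j_sq_le {k : ℕ} {f : RK k → ℂ} (hf : RapidDecay f) (j : Fin k) :
    ∫ p, ‖P0j j f p‖ ^ 2 ≤ ∫ p, ‖f p‖ ^ 2 := by
  refine integral_norm_sq_le_of_slice (hf.P0j j) hf j fun p => ?_
  simp_rw [P0j_eq, coeffZ_setZ, setZ_apply_self]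
  exact integral_norm_proj_sq_le (hf.slice j p).memLp_two

theorem integral_norm_P1j_sq_le {k : ℕ} {f g : RK k → ℂ} (hf : RapidDecay f)
    (hg : RapidDecay g) {j : Fin k} (h : IsAnnih j f g) :
    ∫ p, ‖P1j j f p‖ ^ 2 ≤ ∫ p, ‖g p‖ ^ 2 := by
  refine integral_norm_sq_le_of_slice (hf.P1j j) hg j fun p => ?_
  simp_rw [P1j, P0j_eq, coeffZ_setZ, setZ_apply_self]
  exact integral_norm_sub_proj_sq_le_of_hasDerivAt (hg.slice j p).continuous (h p)
    (hf.slice j p).memLp_two (hg.slice j p).memLp_two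

/-- Composition along a list of indices of the projections selected by `α`. -/
def PList {k : ℕ} (α : Fin k → Bool) (l : List (Fin k)) (f : RK k → ℂ) : RK k → ℂ :=
  l.foldr (fun j g => if α j then P1j j g else P0j j g) f

theorem PList_cons {k : ℕ} (α : Fin k → Bool) (j : Fin k) (l : List (Fin k)) (f : RK k → ℂ) :
    PList α (j :: l) f = if α j then P1j j (PList α l f) else P0j j (PList α l f) := rfl

theorem RapidDecay.PList {k : ℕ} (α : Fin k → Bool) (l : List (Fin k)) {f : RK k → ℂ}
    (hf : RapidDecay f) : RapidDecay (PList α l f) := by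
  induction l with
  | nil => exact hf
  | cons j l ih =>
    rw [PList_cons]
    split_ifs
    · exact ih.P1j j
    · exact ih.P0j j

theorem IsAnnih.PList {k : ℕ} (α : Fin k → Bool) {i : Fin k} {l : List (Fin k)} (hi : i ∉ l)
    {f g : RK k → ℂ} (hf : RapidDecay f) (hg : RapidDecay g) (h : IsAnnih i f g) :
    IsAnnih i (PList α l f) (PList α l g) := by
  induction l with
  | nil => exact h
  | cons j l ih =>
    rw [List.mem_cons, not_or] at hi
    rw [PList_cons, PList_cons]
    split_ifs
    · exact (ih hi.2).P1j hi.1 (hf.PList α l) (hg.PList α l)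
    · exact (ih hi.2).P0j hi.1 (hf.PList α l) (hg.PList α l)

theorem isAnnih_annih {k : ℕ} (i : Fin k) (f : 𝓢(RK k, ℂ)) : IsAnnih i ⇑f ⇑(annih i f) := by
  intro p z
  have hs : HasDerivAt (setZ i p) (dirK i ez) z := by
    refine hasDerivAt_pi.2 fun j => ?_
    rcases eq_or_ne j i with rfl | h
    · simp only [setZ_apply_self, dirK, if_true, ez]
      exact (hasDerivAt_const z _).prodMk (hasDerivAt_id z)
    · simp only [setZ_apply_of_ne h, dirK, if_neg h]
      exact hasDerivAt_const z _
  convert! (f.hasFDerivAt (setZ i p z)).comp_hasDerivAt z hs using 1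
  simp [annih, dirD_apply, mulZ_apply]

theorem PList_energy_bound {k : ℕ} {ω : ℝ} (hω : 1 ≤ ω) (α : Fin k → Bool) {l : List (Fin k)}
    (hl : l.Nodup) (f : 𝓢(RK k, ℂ)) :
    ω ^ (l.countP fun j => α j) * ∫ p, ‖PList α l f p‖ ^ 2 ≤ (innerS f (S2List ω l f)).re := by
  have hω0 : 0 ≤ ω := zero_le_one.trans hω
  induction l generalizing f with
  | nil =>
    have h (p : RK k) : (starRingEnd ℂ) (f p) * f p = ((‖f p‖ ^ 2 : ℝ) : ℂ) := by
      rw [← Complex.normSq_eq_conj_mul_self, Complex.normSq_eq_norm_sq]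
    have h' : innerS f (S2List ω [] f) = ((∫ p, ‖f p‖ ^ 2 : ℝ) : ℂ) := by
      rw [← integral_complex_ofReal]
      exact integral_congr_ae (Filter.Eventually.of_forall h)
    rw [h', Complex.ofReal_re]
    simp [PList]
  | cons j l ih =>
    rw [List.nodup_cons] at hl
    have ih := ih hl.2
    have hnonneg (g : 𝓢(RK k, ℂ)) : 0 ≤ (innerS g (S2List ω l g)).re :=
      le_trans (mul_nonneg (by positivity) (integral_nonneg fun _ => by positivity)) (ih g)
    rw [innerS_S2List_cons ω hl.1]
    simp only [Complex.add_re, Complex.re_ofReal_mul]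
    have h0 := hnonneg (dirD (dirK j ex0) f)
    have h1 := hnonneg (dirD (dirK j ex1) f)
    have hf := (rapidDecay_schwartz f).PList α l
    rw [PList_cons, List.countP_cons]
    split_ifs with hα
    · have hP := integral_norm_P1j_sq_le hf ((rapidDecay_schwartz (annih j f)).PList α l)
        ((isAnnih_annih j f).PList α hl.1 (rapidDecay_schwartz f) (rapidDecay_schwartz _))
      have hA := mul_le_mul_of_nonneg_left
        ((mul_le_mul_of_nonneg_left hP (by positivity)).trans (ih (annih j f))) hω0
      rw [pow_succ', mul_assoc]
      linarith [hnonneg f]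
    · have hP := (mul_le_mul_of_nonneg_left (integral_norm_P0j_sq_le hf j)
        (by positivity)).trans (ih f)
      have hA := mul_nonneg hω0 (hnonneg (annih j f))
      rw [add_zero]
      linarith

/-- `‖P_α ψ‖²_{L²} ≤ ω^{-|α|} ⟨ψ, ∏_j S̃_j² ψ⟩`. -/
theorem projection_energy_bound (k : ℕ) (hk : 1 ≤ k) (ω : ℝ) (hω : 1 ≤ ω)
    (ψ : SchwartzMap (RK k) ℂ) (α : Fin k → Bool) :
    (∫ p : RK k, ‖Palpha α (⇑ψ) p‖ ^ 2) ≤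
      (ω ^ ((Finset.univ.filter fun j : Fin k => α j = true).card : ℕ))⁻¹ *
        (∫ p : RK k, (starRingEnd ℂ) (ψ p) * SprodK ω (⇑ψ) p).re := by
  have h := PList_energy_bound hω α (List.nodup_finRange k) ψ
  have hcount : (List.finRange k).countP (fun j => α j) =
      (Finset.univ.filter fun j : Fin k => α j = true).card := by
    rw [List.countP_eq_length_filter, ← List.toFinset_card_of_nodup
      ((List.nodup_finRange k).filter _)]
    congr 1
    ext j
    simp
  rw [hcount] at h
  rw [inv_mul_eq_div, le_div_iff₀' (pow_pos (zero_lt_one.trans_le hω) _), SprodK, foldr_S2tj]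
  exact h
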